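/- If J_0 ∈ Spec_n(G_{m,n}), then the zero locus Z(J_0) ⊆ U_{m,n} is irreducible. -/

import Mathlib

set_option linter.unusedSectionVars false

noncomputable section

universe u

-- Throughout, `k` is an algebraically closed base field of characteristic zero.
variable (k : Type) [Field k] [IsAlgClosed k] [CharZero k]

/-- Index type for the `m·n²` commuting variables `x_{ij}^{(h)}`. -/
abbrev MIdx (n m : ℕ) := Fin m × Fin n × Fin n

/-- The commutative polynomial ring `k[x_{ij}^{(h)}]`. -/
abbrev PolyRing (n m : ℕ) := MvPolynomial (MIdx n m) k

/-- Matrices over the polynomial ring `k[x_{ij}^{(h)}]`. -/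
abbrev MatPoly (n m : ℕ) := Matrix (Fin n) (Fin n) (PolyRing k n m)

/-- The space `(M_n)^m` of `m`-tuples of `n×n` matrices over `k`. -/
abbrev MTuple (n m : ℕ) := Fin m → Matrix (Fin n) (Fin n) k

/-- The `h`-th generic `n×n` matrix `X_h = (x_{ij}^{(h)})`. -/
def genericMatrix (n m : ℕ) (h : Fin m) : MatPoly k n m :=
  Matrix.of fun i j => MvPolynomial.X (h, i, j)

/-- `G_{m,n}`, the algebra of `m` generic `n×n` matrices: the `k`-subalgebra of
`M_n(k[x_{ij}^{(h)}])` generated by the generic matrices. -/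
def GMN (n m : ℕ) : Subalgebra k (MatPoly k n m) :=
  Algebra.adjoin k (Set.range (genericMatrix k n m))

/-- Evaluation of the commuting variables at a point `a ∈ (M_n)^m`. -/
def polyEval {n m : ℕ} (a : MTuple k n m) : PolyRing k n m →ₐ[k] k :=
  MvPolynomial.aeval fun x : MIdx n m => a x.1 x.2.1 x.2.2

/-- Evaluation of matrix-valued polynomials at a point `a ∈ (M_n)^m`; under this
map an element of `G_{m,n}` (or `T_{m,n}`) becomes a `PGL_n`-equivariant polynomial
map `(M_n)^m → M_n`. -/
def evalMat {n m : ℕ} (a : MTuple k n m) :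
    MatPoly k n m →ₐ[k] Matrix (Fin n) (Fin n) k :=
  (polyEval k a).mapMatrix

/-- The scalar matrix `tr(p)·1 ∈ M_n(k[x_{ij}^{(h)}])`. -/
def traceScalar {n m : ℕ} (p : MatPoly k n m) : MatPoly k n m :=
  algebraMap (PolyRing k n m) (MatPoly k n m) (Matrix.trace p)

/-- `T_{m,n}`, the trace ring of `G_{m,n}`: the `k`-algebra generated inside
`M_n(k[x_{ij}^{(h)}])` by `G_{m,n}` together with the traces of its elements. -/
def TMN (n m : ℕ) : Subalgebra k (MatPoly k n m) :=
  Algebra.adjoin k ((GMN k n m : Set (MatPoly k n m)) ∪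
    (traceScalar k '' (GMN k n m : Set (MatPoly k n m))))

lemma GMN_le_TMN (n m : ℕ) : GMN k n m ≤ TMN k n m :=
  fun _ hx => Algebra.subset_adjoin (Or.inl hx)

/-- The inclusion `G_{m,n} → T_{m,n}`. -/
def inclGT (n m : ℕ) : ↥(GMN k n m) →+* ↥(TMN k n m) :=
  (Subalgebra.inclusion (GMN_le_TMN k n m) : ↥(GMN k n m) →ₐ[k] ↥(TMN k n m)).toRingHom

/-- `U_{m,n}`: the set of `m`-tuples of `n×n` matrices generating `M_n` as a
`k`-algebra. -/
def genTuples (n m : ℕ) : Set (MTuple k n m) :=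
  {a | Algebra.adjoin k (Set.range a) = ⊤}

/-- Simultaneous conjugation of an `m`-tuple by `g ∈ GL_n(k)`; since scalar
matrices act trivially, this is the `PGL_n`-action on `(M_n)^m`. -/
def conjAct {n m : ℕ} (g : GL (Fin n) k) (a : MTuple k n m) : MTuple k n m :=
  fun i =>
    (g : Matrix (Fin n) (Fin n) k) * a i * ((g⁻¹ : GL (Fin n) k) : Matrix (Fin n) (Fin n) k)

/-- Zariski closed subsets of `(M_n)^m`. -/
def IsZClosed {n m : ℕ} (C : Set (MTuple k n m)) : Prop :=
  ∃ S : Set (PolyRing k n m), C = {a | ∀ p ∈ S, polyEval k a p = 0}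

/-- `X` is an `n`-variety: a closed `PGL_n`-invariant subvariety of `U_{m,n}`,
i.e. `X = X̄ ∩ U_{m,n}` where `X̄` is the Zariski closure of `X` in `(M_n)^m`. -/
def IsNVariety {n m : ℕ} (X : Set (MTuple k n m)) : Prop :=
  X ⊆ genTuples k n m ∧
  (∀ g : GL (Fin n) k, ∀ a ∈ X, conjAct k g a ∈ X) ∧
  ∃ C, IsZClosed k C ∧ X = C ∩ genTuples k n m

/-- Irreducibility of a subset of `(M_n)^m` with respect to the Zariski topology. -/
def IsIrredSubset {n m : ℕ} (X : Set (MTuple k n m)) : Prop :=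
  X.Nonempty ∧ ∀ C₁ C₂ : Set (MTuple k n m), IsZClosed k C₁ → IsZClosed k C₂ →
    X ⊆ C₁ ∪ C₂ → X ⊆ C₁ ∨ X ⊆ C₂

/-- The zero locus in `U_{m,n}` of a set of matrix-valued polynomials. -/
def zeroLocus {n m : ℕ} (S : Set (MatPoly k n m)) : Set (MTuple k n m) :=
  {a | a ∈ genTuples k n m ∧ ∀ p ∈ S, evalMat k a p = 0}

/-- The zero locus in `U_{m,n}` of a two-sided ideal of a subalgebra `A` of
`M_n(k[x_{ij}^{(h)}])` (such as `G_{m,n}` or `T_{m,n}`). -/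
def zeroLocusI {n m : ℕ} {A : Subalgebra k (MatPoly k n m)} (J : TwoSidedIdeal ↥A) :
    Set (MTuple k n m) :=
  {a | a ∈ genTuples k n m ∧ ∀ p : ↥A, p ∈ J → evalMat k a (p : MatPoly k n m) = 0}

/-- The vanishing (two-sided) ideal of a subset `X ⊆ (M_n)^m` in a subalgebra `A`
of `M_n(k[x_{ij}^{(h)}])`; for `A = G_{m,n}` this is `I(X)`, for `A = T_{m,n}`
this is `I_T(X)`. -/
def vanishIdeal {n m : ℕ} (A : Subalgebra k (MatPoly k n m)) (X : Set (MTuple k n m)) :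
    TwoSidedIdeal ↥A :=
  TwoSidedIdeal.mk' {p : ↥A | ∀ a ∈ X, evalMat k a (p : MatPoly k n m) = 0}
    (fun a _ => by simp)
    (fun {p q} hp hq a ha => by
      have : ((p + q : ↥A) : MatPoly k n m) = (p : MatPoly k n m) + q := rfl
      simp [this, map_add, hp a ha, hq a ha])
    (fun {p} hp a ha => by
      have : ((-p : ↥A) : MatPoly k n m) = -(p : MatPoly k n m) := rfl
      simp [this, map_neg, hp a ha])
    (fun {p q} hq a ha => by
      have : ((p * q : ↥A) : MatPoly k n m) = (p : MatPoly k n m) * q := rfl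
      simp [this, map_mul, hq a ha])
    (fun {p q} hp a ha => by
      have : ((p * q : ↥A) : MatPoly k n m) = (p : MatPoly k n m) * q := rfl
      simp [this, map_mul, hp a ha])

/-- Restriction: a matrix-valued polynomial gives an `M_n`-valued function on `X`. -/
def restrictTo {n m : ℕ} (X : Set (MTuple k n m)) :
    MatPoly k n m →ₐ[k] (X → Matrix (Fin n) (Fin n) k) :=
  Pi.algHom k _ fun a => evalMat k a.val

/-- The PI-coordinate ring `k_n[X] = G_{m,n}/I(X)`, realized concretely as the
algebra of all restrictions to `X` of elements of `G_{m,n}` (i.e. of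
`PGL_n`-equivariant morphisms `X → M_n` coming from `G_{m,n}`). -/
def coordRing {n m : ℕ} (X : Set (MTuple k n m)) :
    Subalgebra k (X → Matrix (Fin n) (Fin n) k) :=
  (GMN k n m).map (restrictTo k X)

/-- The ring `T_{m,n}/I_T(X)`, realized concretely as the algebra of all
restrictions to `X` of elements of `T_{m,n}`. -/
def coordTraceRing {n m : ℕ} (X : Set (MTuple k n m)) :
    Subalgebra k (X → Matrix (Fin n) (Fin n) k) :=
  (TMN k n m).map (restrictTo k X)

/-- A ring is prime if it is nonzero and `a·R·b = 0` implies `a = 0` or `b = 0`. -/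
def IsPrimeRing (R : Type u) [Ring R] : Prop :=
  Nontrivial R ∧ ∀ a b : R, (∀ x : R, a * x * b = 0) → a = 0 ∨ b = 0

/-- `Q` is a central simple algebra of degree `n`: a simple ring whose center is a
field, and which has dimension `n²` over its center. -/
def IsCSAOfDegree (n : ℕ) (Q : Type u) [Ring Q] : Prop :=
  IsSimpleRing Q ∧
  ∃ (K : Type u) (_ : Field K) (_ : Algebra K Q),
    (algebraMap K Q).range = Subring.center Q ∧ Module.finrank K Q = n ^ 2

/-- A (prime PI-) ring `R` has PI-degree `n` if its total ring of fractions — the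
central localization of `R` at its nonzero central elements — is a central simple
algebra of degree `n`. -/
def HasPIDegree (n : ℕ) (R : Type u) [Ring R] : Prop :=
  ∃ (Q : Type u) (_ : Ring Q) (f : R →+* Q),
    Function.Injective f ∧
    (∀ c ∈ Subring.center R, c ≠ 0 → IsUnit (f c)) ∧
    (∀ q : Q, ∃ r : R, ∃ c ∈ Subring.center R, c ≠ 0 ∧ q * f c = f r) ∧
    IsCSAOfDegree n Q

/-- The quotient of a ring by a two-sided ideal. -/
abbrev idealQuot {R : Type u} [Ring R] (J : TwoSidedIdeal R) : Type u := J.ringCon.Quotient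

/-- `Spec_n(R)`: the set of prime (two-sided) ideals `J` of `R` such that `R/J` is a
prime ring of PI-degree `n`. -/
def SpecN (n : ℕ) (R : Type u) [Ring R] : Set (TwoSidedIdeal R) :=
  {J | IsPrimeRing (idealQuot J) ∧ HasPIDegree n (idealQuot J)}

/-- A regular map of `n`-varieties `X → Y ⊆ U_{l,n}`: a map of the form
`a ↦ (f₁(a), …, f_l(a))` with each `f_i ∈ k_n[X]`, i.e. each component is the
restriction to `X` of an element of `G_{m,n}`. -/
def IsRegMapOn {n m l : ℕ} (X : Set (MTuple k n m)) (Y : Set (MTuple k n l))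
    (φ : MTuple k n m → MTuple k n l) : Prop :=
  (∀ a ∈ X, φ a ∈ Y) ∧
  ∃ F : Fin l → MatPoly k n m, (∀ i, F i ∈ GMN k n m) ∧
    ∀ a ∈ X, ∀ i, φ a i = evalMat k a (F i)

/-- `X` and `Y` are isomorphic `n`-varieties: there are mutually inverse regular
maps of `n`-varieties between them. -/
def NIsomorphic {n m l : ℕ} (X : Set (MTuple k n m)) (Y : Set (MTuple k n l)) : Prop :=
  ∃ (φ : MTuple k n m → MTuple k n l) (ψ : MTuple k n l → MTuple k n m),
    IsRegMapOn k X Y φ ∧ IsRegMapOn k Y X ψ ∧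
    (∀ a ∈ X, ψ (φ a) = a) ∧ (∀ b ∈ Y, φ (ψ b) = b)

noncomputable section
open TensorProduct in
theorem tensor_simple {K L Q : Type} [Field K] [Field L] [Algebra K L] [Ring Q] [Algebra K Q]
    [IsSimpleRing Q] (hc : ∀ q : Q, q ∈ Subring.center Q → ∃ c : K, algebraMap K Q c = q) :
    IsSimpleRing (L ⊗[K] Q) := by
  classical
  have hinj : Function.Injective (Algebra.TensorProduct.includeRight : Q →ₐ[K] L ⊗[K] Q) :=
    Algebra.TensorProduct.includeRight_injective (algebraMap K L).injective
  have : Nontrivial (L ⊗[K] Q) := hinj.nontrivial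
  refine IsSimpleRing.of_eq_bot_or_eq_top fun I => ?_
  by_cases hI : I = ⊥
  · exact Or.inl hI
  right
  let b := Module.Basis.ofVectorSpace K L
  let φ := TensorProduct.equivFinsuppOfBasisLeft (N := Q) b
  have hl : ∀ (q : Q) (x : L ⊗[K] Q) i, φ ((1 ⊗ₜ q) * x) i = q * φ x i := by
    intro q x i
    induction x with
    | zero => simp
    | tmul l q' => simp [φ]
    | add x y hx hy => simp only [mul_add, map_add, Finsupp.add_apply, hx, hy]
  have hr : ∀ (q : Q) (x : L ⊗[K] Q) i, φ (x * (1 ⊗ₜ q)) i = φ x i * q := by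
    intro q x i
    induction x with
    | zero => simp
    | tmul l q' => simp [φ]
    | add x y hx hy => simp only [add_mul, map_add, Finsupp.add_apply, hx, hy]
  have hex : ∃ N, ∃ x ∈ I, x ≠ 0 ∧ (φ x).support.card = N := by
    by_contra h
    push Not at h
    apply hI
    rw [eq_bot_iff]
    intro x hx
    by_contra h0
    exact h _ x hx (fun h' => h0 (by simp [h'])) rfl
  obtain ⟨x, hxI, hx0, hxN⟩ := Nat.find_spec hex
  have hmin : ∀ y ∈ I, (φ y).support.card < (φ x).support.card → y = 0 := by
    intro y hy hlt
    by_contra h0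
    exact Nat.find_min hex (hxN ▸ hlt) ⟨y, hy, h0, rfl⟩
  have hφx : φ x ≠ 0 := by simpa using hx0
  obtain ⟨i0, hi0⟩ := Finsupp.support_nonempty_iff.mpr hφx
  let H : TwoSidedIdeal Q := TwoSidedIdeal.mk'
    {q | ∃ z ∈ I, (φ z).support ⊆ (φ x).support ∧ φ z i0 = q}
    ⟨0, I.zero_mem, by simp, by simp⟩
    (by
      rintro _ _ ⟨z, hz, hs, rfl⟩ ⟨w, hw, ht, rfl⟩
      refine ⟨z + w, I.add_mem hz hw, ?_, by simp⟩
      rw [map_add]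
      exact Finsupp.support_add.trans (Finset.union_subset hs ht))
    (by
      rintro _ ⟨z, hz, hs, rfl⟩
      exact ⟨-z, I.neg_mem hz, by simpa using hs, by simp⟩)
    (by
      rintro q _ ⟨z, hz, hs, rfl⟩
      refine ⟨(1 ⊗ₜ q) * z, I.mul_mem_left _ _ hz, fun i hi => hs ?_, hl _ _ _⟩
      rw [Finsupp.mem_support_iff] at hi ⊢
      intro h; apply hi; rw [hl, h, mul_zero])
    (by
      rintro _ q ⟨z, hz, hs, rfl⟩
      refine ⟨z * (1 ⊗ₜ q), I.mul_mem_right _ _ hz, fun i hi => hs ?_, hr _ _ _⟩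
      rw [Finsupp.mem_support_iff] at hi ⊢
      intro h; apply hi; rw [hr, h, zero_mul])
  have h1 : (1 : Q) ∈ H := IsSimpleRing.one_mem_of_ne_zero_mem H
    (Finsupp.mem_support_iff.mp hi0) ((TwoSidedIdeal.mem_mk' _ _ _ _ _ _ _).mpr ⟨x, hxI, subset_rfl, rfl⟩)
  obtain ⟨z, hz, hzs, hz1⟩ := (TwoSidedIdeal.mem_mk' _ _ _ _ _ _ _).mp h1
  have hcomm : ∀ q : Q, (1 ⊗ₜ q) * z - z * (1 ⊗ₜ q) = 0 := by
    intro q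
    apply hmin
    · exact I.sub_mem (I.mul_mem_left _ _ hz) (I.mul_mem_right _ _ hz)
    · apply Finset.card_lt_card
      refine ⟨fun i hi => hzs ?_, fun h => ?_⟩
      · rw [Finsupp.mem_support_iff] at hi ⊢
        intro h; apply hi; rw [map_sub, Finsupp.sub_apply, hl, hr, h]; simp
      · have := h hi0
        rw [Finsupp.mem_support_iff] at this
        apply this; rw [map_sub, Finsupp.sub_apply, hl, hr, hz1]; simp
  have hcen : ∀ i, ∃ c : K, algebraMap K Q c = φ z i := by
    intro i
    apply hc
    rw [Subring.mem_center_iff]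
    intro q
    have := congrArg (fun w => φ w i) (hcomm q)
    simp only [map_sub, Finsupp.sub_apply, hl, hr, map_zero, Finsupp.zero_apply] at this
    exact sub_eq_zero.mp this
  choose c hc' using hcen
  have hz' : z = (∑ i ∈ (φ z).support, c i • b i) ⊗ₜ (1 : Q) := by
    have h := φ.symm_apply_apply z
    rw [TensorProduct.equivFinsuppOfBasisLeft_symm_apply, Finsupp.sum] at h
    rw [← h, TensorProduct.sum_tmul]
    conv_rhs => rw [h]
    refine Finset.sum_congr rfl fun i _ => ?_
    rw [← hc' i, Algebra.algebraMap_eq_smul_one, TensorProduct.tmul_smul, TensorProduct.smul_tmul']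
  set l := ∑ i ∈ (φ z).support, c i • b i
  have hl0 : l ≠ 0 := by
    intro h0
    rw [h0, TensorProduct.zero_tmul] at hz'
    rw [hz'] at hz1
    simp at hz1
  have : (1 : L ⊗[K] Q) ∈ I := by
    have := I.mul_mem_left (l⁻¹ ⊗ₜ 1) _ hz
    rwa [hz', Algebra.TensorProduct.tmul_mul_tmul, inv_mul_cancel₀ hl0, mul_one] at this
  rw [eq_top_iff]
  intro w _
  simpa using I.mul_mem_left w _ this

/-- splitting data for a prime of PI degree n -/
theorem exists_split {n : ℕ} (hn : 1 ≤ n) (R : Type) [Ring R] (h : HasPIDegree n R) :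
    ∃ (L : Type) (_ : Field L) (ψ : R →+* Matrix (Fin n) (Fin n) L),
      Function.Injective ψ ∧ Submodule.span L (Set.range ψ) = ⊤ ∧
      ∃ ι : Subring.center R →+* L, ∀ c : Subring.center R, ψ (c : R) = Matrix.scalar (Fin n) (ι c) := by
  obtain ⟨Q, _, f, hf, hunit, hfrac, hsimple, K, _, _, hK, hrank⟩ := h
  have hc : ∀ q : Q, q ∈ Subring.center Q → ∃ c : K, algebraMap K Q c = q := by
    intro q hq; rw [← hK] at hq; exact hq
  have hfc : ∀ c ∈ Subring.center R, f c ∈ Subring.center Q := by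
    intro c hcc
    rw [Subring.mem_center_iff] at hcc ⊢
    intro q
    obtain ⟨r, d, hd, hd0, hq⟩ := hfrac q
    have hu := hunit d hd hd0
    apply hu.mul_right_cancel
    rw [Subring.mem_center_iff] at hd
    rw [mul_assoc, ← map_mul, hd c, map_mul, ← mul_assoc, hq, mul_assoc, hq, ← map_mul, ← map_mul, hcc]
  have hfin : FiniteDimensional K Q := by
    apply FiniteDimensional.of_finrank_pos; rw [hrank]; positivity
  let L := AlgebraicClosure K
  have := tensor_simple (L := L) hc
  obtain ⟨r, _, ⟨e⟩⟩ := IsSimpleRing.exists_algEquiv_matrix_of_isAlgClosed L (TensorProduct K L Q)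
  have hr : r = n := by
    have h := e.toLinearEquiv.finrank_eq
    rw [Module.finrank_baseChange, hrank, Module.finrank_matrix] at h
    simp at h
    nlinarith
  subst hr
  let inc : Q →ₐ[K] TensorProduct K L Q := Algebra.TensorProduct.includeRight
  have hinc : Function.Injective inc :=
    Algebra.TensorProduct.includeRight_injective (algebraMap K L).injective
  let g : Q →+* Matrix (Fin r) (Fin r) L := (e : TensorProduct K L Q ≃ₐ[L] _).toAlgHom.toRingHom.comp inc.toRingHom
  have hg : ∀ c : K, g (algebraMap K Q c) = Matrix.scalar (Fin r) (algebraMap K L c) := by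
    intro c
    have h1 : inc (algebraMap K Q c) = algebraMap L _ (algebraMap K L c) := by
      rw [AlgHom.commutes]; rfl
    show e (inc _) = _
    rw [h1, AlgEquiv.commutes]
    rfl
  have hnt : Nontrivial Q := inferInstance
  let j : K →+* Q := algebraMap K Q
  let jr := RingHom.rangeRestrict j
  have hj : Function.Bijective jr := ⟨fun x y h => j.injective (congrArg Subtype.val h), j.rangeRestrict_surjective⟩
  let je := RingEquiv.ofBijective jr hj
  let fc : Subring.center R →+* j.range := (f.comp (Subring.center R).subtype).codRestrict j.range
    (fun c => by show f c ∈ (algebraMap K Q).range; rw [hK]; exact hfc c c.2)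
  refine ⟨L, inferInstance, g.comp f, ?_, ?_, (algebraMap K L).comp ((je.symm : _ →+* K).comp fc), ?_⟩
  · exact (e.injective.comp hinc).comp hf
  · have h1 : ∀ q : Q, g q ∈ Submodule.span L (Set.range (g.comp f)) := by
      intro q
      obtain ⟨r', d, hd, hd0, hq⟩ := hfrac q
      obtain ⟨c, hcd⟩ := hc _ (hfc d hd)
      have hc0 : c ≠ 0 := by
        rintro rfl
        rw [map_zero] at hcd
        exact (hunit d hd hd0).ne_zero hcd.symm
      have : g q = algebraMap K L c⁻¹ • (g.comp f) r' := by
        rw [show (g.comp f) r' = g (f r') from rfl, ← hq, ← hcd, map_mul, hg]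
        rw [← Matrix.scalar_comm _ (fun _ => Commute.all _ _), Matrix.scalar_apply, ← Matrix.smul_eq_diagonal_mul, smul_smul, ← map_mul, inv_mul_cancel₀ hc0, map_one, one_smul]
      rw [this]
      exact Submodule.smul_mem _ _ (Submodule.subset_span ⟨_, rfl⟩)
    rw [eq_top_iff]
    intro M _
    obtain ⟨x, rfl⟩ := e.surjective M
    induction x with
    | zero => simp
    | add x y hx hy => rw [map_add]; exact Submodule.add_mem _ (hx trivial) (hy trivial)
    | tmul l q =>
      have : e (l ⊗ₜ[K] q) = l • g q := by
        show _ = l • e (1 ⊗ₜ[K] q)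
        rw [← map_smul, TensorProduct.smul_tmul', smul_eq_mul, mul_one]
      rw [this]
      exact Submodule.smul_mem _ _ (h1 q)
  · intro c
    have h2 : f c = algebraMap K Q (je.symm (fc c)) := by
      have := congrArg Subtype.val (je.apply_symm_apply (fc c))
      exact this.symm
    rw [RingHom.comp_apply, h2, hg]
    rfl
end

noncomputable section
/-- evaluation at a tuple of matrices over a commutative algebra -/
def evL (k : Type) [Field k] {n m : ℕ} {S : Type} [CommRing S] [Algebra k S]
    (y : Fin m → Matrix (Fin n) (Fin n) S) : MatPoly k n m →ₐ[k] Matrix (Fin n) (Fin n) S :=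
  (MvPolynomial.aeval fun x : MIdx n m => y x.1 x.2.1 x.2.2).mapMatrix

section ev
variable {k : Type} [Field k] {n m : ℕ} {S : Type} [CommRing S] [Algebra k S]

theorem evL_apply (y : Fin m → Matrix (Fin n) (Fin n) S) (p : MatPoly k n m) (i j : Fin n) :
    evL k y p i j = (MvPolynomial.aeval fun x : MIdx n m => y x.1 x.2.1 x.2.2) (p i j) := rfl

theorem evL_generic (y : Fin m → Matrix (Fin n) (Fin n) S) (h : Fin m) :
    evL k y (genericMatrix k n m h) = y h := by
  ext i j
  rw [evL_apply]
  simp [genericMatrix]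

theorem evL_smul (y : Fin m → Matrix (Fin n) (Fin n) S) (q : PolyRing k n m) (p : MatPoly k n m) :
    evL k y (q • p) = (MvPolynomial.aeval fun x : MIdx n m => y x.1 x.2.1 x.2.2) q • evL k y p := by
  ext i j
  simp [evL_apply]

theorem evL_trace (y : Fin m → Matrix (Fin n) (Fin n) S) (p : MatPoly k n m) :
    (MvPolynomial.aeval fun x : MIdx n m => y x.1 x.2.1 x.2.2) p.trace = (evL k y p).trace := by
  simp [Matrix.trace, evL_apply]

theorem evL_conj (y : Fin m → Matrix (Fin n) (Fin n) S) (g g' : Matrix (Fin n) (Fin n) S)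
    (h1 : g * g' = 1) (h2 : g' * g = 1) (p : MatPoly k n m) (hp : p ∈ GMN k n m) :
    evL k (fun h => g * y h * g') p = g * evL k y p * g' := by
  induction hp using Algebra.adjoin_induction with
  | mem x hx =>
    obtain ⟨h, rfl⟩ := hx
    rw [evL_generic, evL_generic]
  | algebraMap r =>
    rw [AlgHom.commutes, AlgHom.commutes, ← Algebra.commutes, mul_assoc, h1, mul_one]
  | add x y _ _ hx hy => rw [map_add, map_add, hx, hy, mul_add, add_mul]
  | mul x y _ _ hx hy =>
    rw [map_mul, map_mul, hx, hy]
    simp only [mul_assoc]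
    rw [← mul_assoc g' g, h2, one_mul]

theorem evalMat_surj (a : MTuple k n m) (ha : a ∈ genTuples k n m)
    (M : Matrix (Fin n) (Fin n) k) : ∃ p ∈ GMN k n m, evL k a p = M := by
  have : (GMN k n m).map (evL k a) = ⊤ := by
    rw [GMN, AlgHom.map_adjoin, ← ha]
    congr 1
    ext x
    simp [evL_generic]
  have h : M ∈ (GMN k n m).map (evL k a) := by rw [this]; trivial
  exact h
end ev

theorem alt_trace {R V W ι : Type} [CommRing R] [AddCommGroup V] [Module R V] [AddCommGroup W]
    [Module R W] [Fintype ι] [DecidableEq ι] (b : Module.Basis ι R V) (F : V [⋀^ι]→ₗ[R] W)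
    (T : V →ₗ[R] V) (t : ι → V) :
    ∑ i, F (Function.update t i (T (t i))) = (∑ j, b.repr (T (b j)) j) • F t := by
  let A : MultilinearMap R (fun _ : ι => V) W :=
    ∑ i, F.toMultilinearMap.compLinearMap (fun j => if j = i then T else LinearMap.id)
  have hA : ∀ t, A t = ∑ i, F (Function.update t i (T (t i))) := by
    intro t
    simp only [A, sum_apply, MultilinearMap.compLinearMap_apply]
    refine Finset.sum_congr rfl fun i _ => ?_
    show F _ = F _
    congr 1
    ext j
    by_cases h : j = i
    · subst h; simp
    · simp [h]
  suffices h : A = (∑ j, b.repr (T (b j)) j) • F.toMultilinearMap by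
    rw [← hA, h]; rfl
  refine Module.Basis.ext_multilinear (fun _ => b) fun f => ?_
  rw [hA]
  show _ = (∑ j, b.repr (T (b j)) j) • F (fun i => b (f i))
  by_cases hf : Function.Injective f
  · have hb : Function.Bijective f := Finite.injective_iff_bijective.mp hf
    rw [← Equiv.sum_comp (Equiv.ofBijective f hb) (fun j => b.repr (T (b j)) j), Finset.sum_smul]
    refine Finset.sum_congr rfl fun i _ => ?_
    conv_lhs => rw [← b.sum_repr (T (b (f i)))]
    rw [F.map_update_sum, Finset.sum_eq_single (f i)]
    · rw [F.map_update_smul]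
      congr 2
      exact Function.update_eq_self i (fun i => b (f i))
    · intro j _ hj
      obtain ⟨i', rfl⟩ := hb.2 j
      have hne : i' ≠ i := fun h => hj (by rw [h])
      rw [F.map_update_smul, F.map_eq_zero_of_eq _ (i := i) (j := i') (by simp [hne]) hne.symm, smul_zero]
    · simp
  · rw [Function.Injective] at hf
    push Not at hf
    obtain ⟨p, q, hpq, hne⟩ := hf
    rw [F.map_eq_zero_of_eq _ (i := p) (j := q) (by simp [hpq]) hne, smul_zero]
    rw [← Finset.sum_subset (Finset.subset_univ {p, q}), Finset.sum_pair hne]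
    · have : Function.update (fun i => b (f i)) q (T (b (f q))) =
          (Function.update (fun i => b (f i)) p (T (b (f p)))) ∘ Equiv.swap p q := by
        ext j
        by_cases h1 : j = q
        · subst h1; simp [hpq]
        · by_cases h2 : j = p
          · subst h2; simp [hne, hne.symm, hpq]
          · simp [h1, h2, Equiv.swap_apply_of_ne_of_ne h2 h1]
      rw [this, F.map_swap _ hne, add_neg_cancel]
    · intro i _ hi
      simp only [Finset.mem_insert, Finset.mem_singleton, not_or] at hi
      exact F.map_eq_zero_of_eq _ (i := p) (j := q)
        (by simp [Ne.symm hi.1, Ne.symm hi.2, hpq]) hne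

/-- Capelli-type alternating map -/
def cap {R : Type} [CommRing R] {n : ℕ} (N : ℕ) (l r : Fin N → Matrix (Fin n) (Fin n) R) :
    (Matrix (Fin n) (Fin n) R) [⋀^Fin N]→ₗ[R] Matrix (Fin n) (Fin n) R :=
  MultilinearMap.alternatization ((MultilinearMap.mkPiAlgebraFin R N _).compLinearMap fun i =>
    (LinearMap.mulLeft R (l i)).comp (LinearMap.mulRight R (r i)))

theorem cap_apply {R : Type} [CommRing R] {n : ℕ} (N : ℕ) (l r t : Fin N → Matrix (Fin n) (Fin n) R) :
    cap N l r t = ∑ σ : Equiv.Perm (Fin N), Equiv.Perm.sign σ •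
      (List.ofFn fun i => l i * (t (σ i) * r i)).prod := by
  rw [cap, MultilinearMap.alternatization_apply]
  rfl

theorem cap_map {R S : Type} [CommRing R] [CommRing S] {n : ℕ} (N : ℕ)
    (l r t : Fin N → Matrix (Fin n) (Fin n) R)
    (φ : Matrix (Fin n) (Fin n) R →+* Matrix (Fin n) (Fin n) S) :
    φ (cap N l r t) = cap N (fun i => φ (l i)) (fun i => φ (r i)) (fun i => φ (t i)) := by
  rw [cap_apply, cap_apply, map_sum]
  refine Finset.sum_congr rfl fun σ _ => ?_
  rw [Units.smul_def, Units.smul_def, map_zsmul, map_list_prod, List.map_ofFn]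
  congr 3
  ext i
  simp

theorem cap_ne_zero {R : Type} [CommRing R] [Nontrivial R] {n N : ℕ} (z : Fin n)
    (e : Fin N ≃ Fin n × Fin n) :
    cap N (fun i => Matrix.single z (e i).1 (1 : R)) (fun i => Matrix.single (e i).2 z 1)
      (fun i => Matrix.single (e i).1 (e i).2 1) * Matrix.single z z 1 ≠ 0 := by
  have key : ∀ L : List (Matrix (Fin n) (Fin n) R), (∀ x ∈ L, x = Matrix.single z z 1) →
      L.prod * Matrix.single z z 1 = Matrix.single z z 1 := by
    intro L
    induction L with
    | nil => simp
    | cons x L ih =>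
      intro h
      rw [List.prod_cons, mul_assoc, ih (fun w hw => h w (List.mem_cons_of_mem _ hw)), h x List.mem_cons_self]
      simp
  rw [cap_apply, Finset.sum_eq_single 1]
  · rw [Equiv.Perm.sign_one, one_smul, key]
    · intro h
      have := congrFun (congrFun h z) z
      simp at this
    · intro x hx
      rw [List.mem_ofFn] at hx
      obtain ⟨i, rfl⟩ := hx
      simp
  · intro σ _ hσ
    obtain ⟨i, hi⟩ : ∃ i, σ i ≠ i := by
      by_contra h
      push Not at h
      exact hσ (Equiv.ext h)
    have h0 : (0 : Matrix (Fin n) (Fin n) R) ∈ (List.ofFn fun i => Matrix.single z (e i).1 (1 : R) *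
        (Matrix.single (e (σ i)).1 (e (σ i)).2 1 * Matrix.single (e i).2 z 1)) := by
      rw [List.mem_ofFn]
      refine ⟨i, ?_⟩
      by_cases h1 : (e i).1 = (e (σ i)).1
      · by_cases h2 : (e (σ i)).2 = (e i).2
        · exact absurd (e.injective (Prod.ext h1.symm h2)) hi
        · simp [h2]
      · simp only [← mul_assoc]
        rw [Matrix.single_mul_single_of_ne (h := h1), zero_mul]
    have hz : ∀ L : List (Matrix (Fin n) (Fin n) R), 0 ∈ L → L.prod = 0 := by
      intro L
      induction L with
      | nil => simp
      | cons x L ih =>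
        intro h
        rcases List.mem_cons.mp h with h | h
        · rw [List.prod_cons, ← h, zero_mul]
        · rw [List.prod_cons, ih h, mul_zero]
    rw [hz _ h0, smul_zero]
  · simp

section tr
variable (k : Type) [Field k] (n m : ℕ)

/-- algebra generated by traces -/
def traceAlg : Subalgebra k (PolyRing k n m) :=
  Algebra.adjoin k {q | ∃ p ∈ GMN k n m, q = p.trace}

/-- span of Capelli elements -/
def capSpan : Submodule k (MatPoly k n m) :=
  Submodule.span k {c | ∃ l r t : Fin (n * n) → MatPoly k n m, (∀ i, l i ∈ GMN k n m) ∧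
    (∀ i, r i ∈ GMN k n m) ∧ (∀ i, t i ∈ GMN k n m) ∧ c = cap (n * n) l r t}

variable {k n m}

theorem capSpan_le {c : MatPoly k n m} (hc : c ∈ capSpan k n m) : c ∈ GMN k n m := by
  induction hc using Submodule.span_induction with
  | zero => exact zero_mem _
  | add x y _ _ hx hy => exact add_mem hx hy
  | smul a x _ hx => exact Subalgebra.smul_mem _ hx a
  | mem x hx =>
    obtain ⟨l, r, t, hl, hr, ht, rfl⟩ := hx
    rw [cap_apply]
    refine sum_mem fun σ _ => ?_
    rw [Units.smul_def]
    refine zsmul_mem ?_ _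
    refine list_prod_mem fun x hx => ?_
    rw [List.mem_ofFn] at hx
    obtain ⟨i, rfl⟩ := hx
    exact mul_mem (hl i) (mul_mem (ht _) (hr i))

theorem trace_mulLeft_std {R : Type} [CommRing R] (z : Matrix (Fin n) (Fin n) R)
    (e : Fin (n * n) ≃ Fin n × Fin n) :
    (∑ j, ((Matrix.stdBasis R (Fin n) (Fin n)).reindex e.symm).repr
      (LinearMap.mulLeft R z (((Matrix.stdBasis R (Fin n) (Fin n)).reindex e.symm) j)) j)
      = (n : R) * z.trace := by
  rw [← Equiv.sum_comp e.symm]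
  simp only [Module.Basis.reindex_apply, Module.Basis.repr_reindex, Finsupp.mapDomain_equiv_apply,
    Equiv.symm_symm, Equiv.apply_symm_apply]
  rw [Fintype.sum_prod_type]
  have h : ∀ i j : Fin n, (Matrix.stdBasis R (Fin n) (Fin n)).repr
      (LinearMap.mulLeft R z (Matrix.stdBasis R (Fin n) (Fin n) (i, j))) (i, j) = z i i := by
    intro i j
    rw [Matrix.stdBasis_eq_single]
    have : ∀ M : Matrix (Fin n) (Fin n) R, (Matrix.stdBasis R (Fin n) (Fin n)).repr M (i, j) = M i j := by
      intro M
      simp [Matrix.stdBasis]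
    rw [this]
    simp
  simp only [h]
  simp [Matrix.trace, Finset.mul_sum]

theorem traceAlg_smul [CharZero k] (hn : 1 ≤ n) {q : PolyRing k n m} (hq : q ∈ traceAlg k n m) :
    ∀ c ∈ capSpan k n m, q • c ∈ capSpan k n m := by
  induction hq using Algebra.adjoin_induction with
  | algebraMap r =>
    intro c hc
    rw [algebraMap_smul]
    exact Submodule.smul_mem _ _ hc
  | add x y _ _ hx hy => intro c hc; rw [add_smul]; exact add_mem (hx c hc) (hy c hc)
  | mul x y _ _ hx hy => intro c hc; rw [mul_smul]; exact hx _ (hy c hc)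
  | mem x hx =>
    obtain ⟨z, hz, rfl⟩ := hx
    intro c hc
    induction hc using Submodule.span_induction with
    | zero => rw [smul_zero]; exact zero_mem _
    | add x y _ _ hx hy => rw [smul_add]; exact add_mem hx hy
    | smul a x _ hx => rw [smul_comm]; exact Submodule.smul_mem _ _ hx
    | mem x hx =>
      obtain ⟨l, r, t, hl, hr, ht, rfl⟩ := hx
      let e : Fin (n * n) ≃ Fin n × Fin n := finProdFinEquiv.symm
      have h := alt_trace ((Matrix.stdBasis (PolyRing k n m) (Fin n) (Fin n)).reindex e.symm)
        (cap (n * n) l r) (LinearMap.mulLeft _ z) t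
      rw [trace_mulLeft_std] at h
      have hn0 : (n : k) ≠ 0 := by
        rw [Nat.cast_ne_zero]; omega
      have h2 : z.trace • cap (n * n) l r t = (n : k)⁻¹ • ((n : PolyRing k n m) * z.trace) • cap (n * n) l r t := by
        rw [mul_smul, Nat.cast_smul_eq_nsmul, ← Nat.cast_smul_eq_nsmul k, smul_smul, inv_mul_cancel₀ hn0, one_smul]
      rw [h2, ← h]
      refine Submodule.smul_mem _ _ (sum_mem fun i _ => Submodule.subset_span
        ⟨l, r, Function.update t i (z * t i), hl, hr, fun j => ?_, rfl⟩)
      by_cases hj : j = i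
      · subst hj; simpa using mul_mem hz (ht j)
      · simpa [hj] using ht j

/-- trace relations specialize -/
theorem trace_specialize [CharZero k] (hn : 1 ≤ n) {S : Type} [CommRing S] [Algebra k S]
    (y : Fin m → Matrix (Fin n) (Fin n) S) (a : MTuple k n m) (ha : a ∈ genTuples k n m)
    (hJ : ∀ p ∈ GMN k n m, evL k y p = 0 → evL k a p = 0)
    (q : PolyRing k n m) (hq : q ∈ traceAlg k n m)
    (h0 : (MvPolynomial.aeval fun x : MIdx n m => y x.1 x.2.1 x.2.2) q = 0) :
    polyEval k a q = 0 := by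
  let e : Fin (n * n) ≃ Fin n × Fin n := finProdFinEquiv.symm
  choose P hP hPa using evalMat_surj a ha
  let z : Fin n := ⟨0, hn⟩
  let c := cap (n * n) (fun i => P (Matrix.single z (e i).1 1)) (fun i => P (Matrix.single (e i).2 z 1))
      (fun i => P (Matrix.single (e i).1 (e i).2 1))
  have hc : c ∈ capSpan k n m := Submodule.subset_span
    ⟨_, _, _, fun i => hP _, fun i => hP _, fun i => hP _, rfl⟩
  have hca : evL k a c ≠ 0 := by
    have := cap_map (n * n) (fun i => P (Matrix.single z (e i).1 1)) (fun i => P (Matrix.single (e i).2 z 1))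
      (fun i => P (Matrix.single (e i).1 (e i).2 1)) (evL k a).toRingHom
    have h2 := cap_ne_zero (R := k) z e
    intro h
    apply h2
    simp only [AlgHom.toRingHom_eq_coe, RingHom.coe_coe, hPa] at this
    rw [← this, h, zero_mul]
  have h1 := hJ _ (capSpan_le (traceAlg_smul hn hq c hc)) (by rw [evL_smul, h0, zero_smul])
  rw [evL_smul] at h1
  exact (smul_eq_zero.mp h1).resolve_right hca
end tr
end

noncomputable section
section
variable {k : Type} [Field k] {n m : ℕ}

theorem exists_val {L : Type} [Field L] [Algebra k L] (y : Fin m → Matrix (Fin n) (Fin n) L)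
    (a : MTuple k n m)
    (hsp : ∀ q ∈ traceAlg k n m, (MvPolynomial.aeval fun x : MIdx n m => y x.1 x.2.1 x.2.2) q = 0 →
      polyEval k a q = 0) :
    ∃ (O : ValuationSubring L) (τ : traceAlg k n m →+* O) (κ : k →+* O),
      (∀ q, (τ q : L) = (MvPolynomial.aeval fun x : MIdx n m => y x.1 x.2.1 x.2.2) (q : PolyRing k n m)) ∧
      (∀ c, (κ c : L) = algebraMap k L c) ∧
      ∀ q, IsLocalRing.residue O (τ q) = IsLocalRing.residue O (κ (polyEval k a q)) := by
  let ea : traceAlg k n m →+* k := ((polyEval k a).comp (traceAlg k n m).val).toRingHom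
  let ey : traceAlg k n m →+* L := ((MvPolynomial.aeval fun x : MIdx n m => y x.1 x.2.1 x.2.2).comp
    (traceAlg k n m).val).toRingHom
  let I := RingHom.ker ea
  have hI : I.IsPrime := RingHom.ker_isPrime ea
  have hu : ∀ s : I.primeCompl, IsUnit (ey s) := by
    intro s
    rw [isUnit_iff_ne_zero]
    intro h
    exact s.2 (hsp s.1 s.1.2 h)
  let F : Localization.AtPrime I →+* L := IsLocalization.lift hu
  obtain ⟨O, hO, hloc⟩ := IsLocalRing.exists_factor_valuationRing (R := Localization.AtPrime I) (K := L) F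
  let τ' : Localization.AtPrime I →+* O := F.codRestrict O.toSubring hO
  have hloc' : IsLocalHom τ' := hloc
  let τ : traceAlg k n m →+* O := τ'.comp (algebraMap _ _)
  have hτ : ∀ q, (τ q : L) = (MvPolynomial.aeval fun x : MIdx n m => y x.1 x.2.1 x.2.2) (q : PolyRing k n m) := by
    intro q
    show F (algebraMap _ _ q) = _
    rw [IsLocalization.lift_eq]
    rfl
  refine ⟨O, τ, τ.comp (algebraMap k _), hτ, ?_, ?_⟩
  · intro c
    rw [RingHom.comp_apply, hτ]
    simp
  · intro q
    rw [← sub_eq_zero, ← map_sub,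
      show (τ.comp (algebraMap k _)) (polyEval k a q) = τ (algebraMap k _ (polyEval k a q)) from rfl,
      ← map_sub, IsLocalRing.residue_eq_zero_iff]
    set w := q - algebraMap k (traceAlg k n m) (polyEval k a q)
    have hw : ea w = 0 := by
      show polyEval k a ((q : PolyRing k n m) - algebraMap k _ (polyEval k a q)) = 0
      simp
    rw [IsLocalRing.mem_maximalIdeal, mem_nonunits_iff]
    intro hun
    have h1 : IsUnit (algebraMap _ (Localization.AtPrime I) w) := isUnit_of_map_unit τ' _ hun
    rw [IsLocalization.AtPrime.isUnit_to_map_iff _ I] at h1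
    exact h1 hw

/-- lifted matrix units are conjugate to the standard ones -/
theorem units_conj {F : Type} [Field F] (hn : 1 ≤ n) (e : Fin n × Fin n → Matrix (Fin n) (Fin n) F)
    (hmul : ∀ i j l, e (i, j) * e (j, l) = e (i, l))
    (hmul0 : ∀ i j j' l, j ≠ j' → e (i, j) * e (j', l) = 0) (hone : ∑ i, e (i, i) = 1) :
    ∃ h : Matrix (Fin n) (Fin n) F, IsUnit h ∧ ∀ i, e i * h = h * Matrix.single i.1 i.2 1 := by
  let z : Fin n := ⟨0, hn⟩
  have h0 : e (z, z) ≠ 0 := by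
    intro h
    have : ∀ i, e (i, i) = 0 := by
      intro i
      rw [← hmul i z i, ← hmul i z z, h, mul_zero, zero_mul]
    simp only [this, Finset.sum_const_zero] at hone
    have := congrFun (congrFun hone z) z
    simp at this
  obtain ⟨w, hw⟩ : ∃ w, (e (z, z)).mulVec w ≠ 0 := by
    by_contra h
    push Not at h
    apply h0
    ext i j
    have := congrFun (h (Pi.single j 1)) i
    simpa using this
  let h : Matrix (Fin n) (Fin n) F := Matrix.of fun r j => (e (j, z)).mulVec w r
  have hcol : ∀ j, h.mulVec (Pi.single j 1) = (e (j, z)).mulVec w := by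
    intro j
    ext r
    simp [h]
  refine ⟨h, ?_, ?_⟩
  · rw [← Matrix.mulVec_injective_iff_isUnit]
    have key : ∀ x, h.mulVec x = 0 → x = 0 := by
      intro x hx
      ext j
      have h1 : h.mulVec x = ∑ i, x i • (e (i, z)).mulVec w := by
        ext r
        simp [h, Matrix.mulVec, dotProduct, mul_comm]
      have h2 : (e (z, j)).mulVec (h.mulVec x) = x j • (e (z, z)).mulVec w := by
        rw [h1, Matrix.mulVec_sum, Finset.sum_eq_single j]
        · rw [Matrix.mulVec_smul, Matrix.mulVec_mulVec, hmul]
        · intro i _ hi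
          rw [Matrix.mulVec_smul, Matrix.mulVec_mulVec, hmul0 _ _ _ _ hi.symm, Matrix.zero_mulVec, smul_zero]
        · simp
      rw [hx, Matrix.mulVec_zero] at h2
      exact (smul_eq_zero.mp h2.symm).resolve_right hw
    intro x x' hxx
    have := key (x - x') (by rw [Matrix.mulVec_sub, sub_eq_zero]; exact hxx)
    exact sub_eq_zero.mp this
  · rintro ⟨i, j⟩
    apply Matrix.ext_of_mulVec_single
    intro l
    rw [← Matrix.mulVec_mulVec, ← Matrix.mulVec_mulVec, hcol, Matrix.mulVec_mulVec]
    by_cases hjl : j = l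
    · subst hjl
      rw [hmul, show (Matrix.single i j (1:F)).mulVec (Pi.single j 1) = Pi.single i 1 by
        ext r; simp [Matrix.single_apply, Pi.single_apply, eq_comm], hcol]
    · rw [hmul0 _ _ _ _ hjl, show (Matrix.single i j (1:F)).mulVec (Pi.single l 1) = 0 by
        ext r; simp [Matrix.single_apply, hjl]]
      simp

/-- coordinates in the lattice spanned by lifts of matrix units -/
theorem lattice_coords {L : Type} [Field L] [Algebra k L] (y : Fin m → Matrix (Fin n) (Fin n) L)
    (a : MTuple k n m) (O : ValuationSubring L) (τ : traceAlg k n m →+* O) (κ : k →+* O)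
    (hτ : ∀ q, (τ q : L) = (MvPolynomial.aeval fun x : MIdx n m => y x.1 x.2.1 x.2.2) (q : PolyRing k n m))
    (hres : ∀ q, IsLocalRing.residue O (τ q) = IsLocalRing.residue O (κ (polyEval k a q)))
    (p : Fin n × Fin n → MatPoly k n m) (hp : ∀ i, p i ∈ GMN k n m)
    (hpa : ∀ i, evL k a (p i) = Matrix.single i.1 i.2 1) :
    LinearIndependent L (fun i => evL k y (p i)) ∧
    ∀ z ∈ GMN k n m, ∃ c : Fin n × Fin n → O, evL k y z = ∑ i, (c i : L) • evL k y (p i) ∧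
      ∀ i, IsLocalRing.residue O (c i) = IsLocalRing.residue O (κ (evL k a z i.1 i.2)) := by
  classical
  have hT : ∀ z ∈ GMN k n m, z.trace ∈ traceAlg k n m := fun z hz => Algebra.subset_adjoin ⟨z, hz, rfl⟩
  let t : GMN k n m → O := fun z => τ ⟨_, hT z.1 z.2⟩
  have ht : ∀ z, (t z : L) = (evL k y z.1).trace := by
    intro z
    rw [← evL_trace]
    exact hτ _
  have htr : ∀ z, IsLocalRing.residue O (t z) = IsLocalRing.residue O (κ (evL k a z.1).trace) := by
    intro z
    rw [← evL_trace]
    exact hres _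
  let Γ : Matrix (Fin n × Fin n) (Fin n × Fin n) O :=
    Matrix.of fun i j => t ⟨p i * p j.swap, mul_mem (hp _) (hp _)⟩
  have hsingle : ∀ (M : Matrix (Fin n) (Fin n) k) (j : Fin n × Fin n),
      (M * Matrix.single j.2 j.1 1).trace = M j.1 j.2 := by
    intro M j
    simp [Matrix.trace_mul_single]
  have hΓ : (IsLocalRing.residue O).mapMatrix Γ = 1 := by
    ext i j
    simp only [RingHom.mapMatrix_apply, Matrix.map_apply, Γ, Matrix.of_apply]
    rw [htr, map_mul, hpa, hpa]
    simp only [Prod.fst_swap, Prod.snd_swap]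
    rw [hsingle, Matrix.one_apply, Matrix.single_apply]
    by_cases h : i = j
    · subst h; simp
    · have : ¬ (i.1 = j.1 ∧ i.2 = j.2) := fun h' => h (Prod.ext h'.1 h'.2)
      simp [h, this]
  have hdet : IsUnit Γ.det := by
    apply (IsLocalRing.residue_ne_zero_iff_isUnit _).mp
    rw [RingHom.map_det, hΓ, Matrix.det_one]
    exact one_ne_zero
  let ΓL := O.subtype.mapMatrix Γ
  have hdetL : IsUnit ΓL.det := by
    rw [← RingHom.map_det]
    exact hdet.map _
  have hexp : ∀ (x : Fin n × Fin n → L) j, ((∑ i, x i • evL k y (p i)) * evL k y (p j.swap)).trace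
      = (Matrix.vecMul x ΓL) j := by
    intro x j
    rw [Finset.sum_mul, Matrix.trace_sum]
    simp only [Matrix.vecMul, dotProduct]
    refine Finset.sum_congr rfl fun i _ => ?_
    rw [smul_mul_assoc, Matrix.trace_smul, smul_eq_mul]
    congr 1
    rw [← map_mul]
    exact (ht ⟨p i * p j.swap, mul_mem (hp _) (hp _)⟩).symm
  have hli : LinearIndependent L (fun i => evL k y (p i)) := by
    rw [Fintype.linearIndependent_iff]
    intro x hx
    have h1 : Matrix.vecMul x ΓL = 0 := by
      ext j
      rw [← hexp, hx]
      simp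
    have h2 : x = 0 := by
      have := congrArg (fun v => Matrix.vecMul v ΓL⁻¹) h1
      simpa [Matrix.vecMul_vecMul, Matrix.mul_nonsing_inv _ hdetL] using this
    intro i; rw [h2]; rfl
  refine ⟨hli, fun z hz => ?_⟩
  have hspan : Submodule.span L (Set.range (fun i => evL k y (p i))) = ⊤ := by
    apply hli.span_eq_top_of_card_eq_finrank'
    rw [Module.finrank_matrix]
    simp
  have hzm : evL k y z ∈ Submodule.span L (Set.range (fun i => evL k y (p i))) := by
    rw [hspan]; trivial
  obtain ⟨x, hx⟩ := (Submodule.mem_span_range_iff_exists_fun L).mp hzm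
  let d : Fin n × Fin n → O := fun j => t ⟨z * p j.swap, mul_mem hz (hp _)⟩
  have hd : Matrix.vecMul x ΓL = fun j => (d j : L) := by
    ext j
    rw [← hexp, hx, ← map_mul]
    exact (ht ⟨z * p j.swap, mul_mem hz (hp _)⟩).symm
  let c := Matrix.vecMul d Γ⁻¹
  have hcΓ : Matrix.vecMul c Γ = d := by
    simp [c, Matrix.vecMul_vecMul, Matrix.nonsing_inv_mul _ hdet]
  have hcx : (fun i => (c i : L)) = x := by
    have h1 : Matrix.vecMul (fun i => (c i : L)) ΓL = Matrix.vecMul x ΓL := by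
      rw [hd]
      ext j
      have := congrArg O.subtype (congrFun hcΓ j)
      rw [RingHom.map_vecMul] at this
      exact this
    have := congrArg (fun v => Matrix.vecMul v ΓL⁻¹) h1
    simpa [Matrix.vecMul_vecMul, Matrix.mul_nonsing_inv _ hdetL] using this
  refine ⟨c, ?_, fun i => ?_⟩
  · rw [← hx, ← hcx]
  · have h1 := congrArg (IsLocalRing.residue O) (congrFun hcΓ i)
    rw [RingHom.map_vecMul, ← RingHom.mapMatrix_apply, hΓ, Matrix.vecMul_one] at h1
    rw [show IsLocalRing.residue O (c i) = _ from h1]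
    rw [htr, map_mul, hpa]
    simp only [Prod.fst_swap, Prod.snd_swap]
    rw [hsingle]
end
end

noncomputable section
section
variable {n : ℕ}

theorem stable_lattice {L : Type} [Field L] (hn : 1 ≤ n) (O : ValuationSubring L)
    (W : Fin n × Fin n → Matrix (Fin n) (Fin n) L) (hli : LinearIndependent L W)
    (hmul : ∀ i j, ∃ c : Fin n × Fin n → O, W i * W j = ∑ l, (c l : L) • W l) :
    ∃ g g' : Matrix (Fin n) (Fin n) L, g * g' = 1 ∧ g' * g = 1 ∧
      ∀ i, ∃ R : Matrix (Fin n) (Fin n) O, O.subtype.mapMatrix R = g' * W i * g := by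
  classical
  let z : Fin n := ⟨0, hn⟩
  let u : Fin n → L := Pi.single z 1
  let v : Fin n × Fin n → Fin n → L := fun i => (W i).mulVec u
  let D : (Fin n → Fin n × Fin n) → L := fun s => (Matrix.of fun j => v (s j)).det
  have : Nonempty (Fin n → Fin n × Fin n) := ⟨fun _ => (z, z)⟩
  obtain ⟨s, hs⟩ := Finite.exists_max (fun s => O.valuation (D s))
  have hD : D s ≠ 0 := by
    intro h0
    have hall : ∀ t, D t = 0 := by
      intro t
      have := hs t
      rw [h0, map_zero] at this
      exact (map_eq_zero _).mp (le_antisymm this zero_le)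
    let b : Module.Basis (Fin n × Fin n) L (Matrix (Fin n) (Fin n) L) :=
      basisOfLinearIndependentOfCardEqFinrank' W hli (by rw [Module.finrank_matrix]; simp)
    have hb : ∀ i, b i = W i := fun i => by simp [b]
    let e : Matrix (Fin n) (Fin n) L →ₗ[L] (Fin n → L) := (Matrix.mulVecBilin L L).flip u
    let f : MultilinearMap L (fun _ : Fin n => Matrix (Fin n) (Fin n) L) L :=
      (Matrix.detRowAlternating (R := L) (n := Fin n)).toMultilinearMap.compLinearMap fun _ => e
    have hf : f = 0 := by
      apply Module.Basis.ext_multilinear (fun _ => b)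
      intro t
      have := hall t
      simp only [hb]
      exact this
    have h1 : f (fun j => Matrix.single j z 1) = 1 := by
      show (Matrix.of fun j => (Matrix.single j z (1:L)).mulVec u).det = 1
      have : (Matrix.of fun j => (Matrix.single j z (1:L)).mulVec u) =
          (1 : Matrix (Fin n) (Fin n) L) := by
        ext i j
        simp [u, Matrix.single_apply, Matrix.one_apply]
      rw [this, Matrix.det_one]
    rw [hf] at h1
    exact zero_ne_one h1
  let B : Matrix (Fin n) (Fin n) L := Matrix.of fun j => v (s j)
  let g : Matrix (Fin n) (Fin n) L := B.transpose
  have hBdet : B.det = D s := rfl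
  have hg : IsUnit g.det := by
    rw [Matrix.det_transpose, hBdet]; exact isUnit_iff_ne_zero.mpr hD
  have hx : ∀ l, ∃ x : Fin n → O, g.mulVec (fun j => (x j : L)) = v l := by
    intro l
    have hmem : ∀ j, (D s)⁻¹ * D (Function.update s j l) ∈ O := by
      intro j
      rw [← O.valuation_le_one_iff, map_mul, map_inv₀]
      rw [inv_mul_le_iff₀ (zero_lt_iff.mpr ((map_ne_zero _).mpr hD)), mul_one]
      exact hs _
    refine ⟨fun j => ⟨_, hmem j⟩, ?_⟩
    have h1 : (fun j => (D s)⁻¹ * D (Function.update s j l)) = (D s)⁻¹ • Matrix.cramer g (v l) := by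
      ext j
      simp only [Pi.smul_apply, smul_eq_mul]
      congr 1
      rw [Matrix.cramer_transpose_apply]
      show Matrix.det _ = _
      congr 1
      ext i r
      by_cases hij : i = j
      · subst hij; simp
      · simp [hij, B]
    show g.mulVec (fun j => (D s)⁻¹ * D (Function.update s j l)) = v l
    rw [h1, Matrix.mulVec_smul, Matrix.mulVec_cramer, Matrix.det_transpose, hBdet, smul_smul,
      inv_mul_cancel₀ hD, one_smul]
  choose x hx using hx
  refine ⟨g, g⁻¹, Matrix.mul_nonsing_inv _ hg, Matrix.nonsing_inv_mul _ hg, fun i => ?_⟩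
  choose c hc using fun j => hmul i (s j)
  let R : Matrix (Fin n) (Fin n) O := Matrix.of fun r j => ∑ l, c j l * x l r
  refine ⟨R, ?_⟩
  have key : W i * g = g * O.subtype.mapMatrix R := by
    apply Matrix.ext_of_mulVec_single
    intro j
    have h1 : g.mulVec (Pi.single j 1) = v (s j) := by
      ext r; simp [g, B]
    have h2 : (O.subtype.mapMatrix R).mulVec (Pi.single j 1)
        = ∑ l, (c j l : L) • (fun r => (x l r : L)) := by
      ext r
      simp [R]
    rw [← Matrix.mulVec_mulVec, ← Matrix.mulVec_mulVec, h1, h2, Matrix.mulVec_sum]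
    simp only [Matrix.mulVec_smul, hx]
    show (W i).mulVec ((W (s j)).mulVec u) = _
    rw [Matrix.mulVec_mulVec, hc, Matrix.sum_mulVec]
    simp only [Matrix.smul_mulVec]
    rfl
  rw [mul_assoc, key, ← mul_assoc, Matrix.nonsing_inv_mul _ hg, one_mul]
end
end

noncomputable section
section
variable {k : Type} [Field k] {n m : ℕ}

theorem specialize_conj [CharZero k] (hn : 1 ≤ n) {L : Type} [Field L] [Algebra k L]
    (y : Fin m → Matrix (Fin n) (Fin n) L) (a : MTuple k n m) (ha : a ∈ genTuples k n m)
    (hJ : ∀ p ∈ GMN k n m, evL k y p = 0 → evL k a p = 0) (f : PolyRing k n m)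
    (hf : ∀ g g' : Matrix (Fin n) (Fin n) L, g * g' = 1 → g' * g = 1 →
      (MvPolynomial.aeval fun x : MIdx n m => (g * y x.1 * g') x.2.1 x.2.2) f = 0) :
    polyEval k a f = 0 := by
  classical
  obtain ⟨O, τ, κ, hτ, hκ, hres⟩ := exists_val y a
    (fun q hq h0 => trace_specialize hn y a ha hJ q hq h0)
  choose p hp hpa using fun i : Fin n × Fin n => evalMat_surj a ha (Matrix.single i.1 i.2 1)
  obtain ⟨hli, hco⟩ := lattice_coords y a O τ κ hτ hres p hp hpa
  obtain ⟨g, g', h1, h2, hR⟩ := stable_lattice hn O _ hli (fun i j => by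
    obtain ⟨c, hc, _⟩ := hco (p i * p j) (mul_mem (hp _) (hp _))
    exact ⟨c, by rw [← hc, map_mul]⟩)
  choose R hR using hR
  let φ : Matrix (Fin n) (Fin n) O →+* Matrix (Fin n) (Fin n) L := O.subtype.mapMatrix
  have hφ : Function.Injective φ := by
    intro A B h
    ext i j
    exact congrFun (congrFun h i) j
  let F := IsLocalRing.ResidueField O
  let r : O →+* F := IsLocalRing.residue O
  let rM : Matrix (Fin n) (Fin n) O →+* Matrix (Fin n) (Fin n) F := r.mapMatrix
  let E : Fin n × Fin n → Matrix (Fin n) (Fin n) F := fun i => rM (R i)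
  have hz : ∀ z ∈ GMN k n m, ∃ Z : Matrix (Fin n) (Fin n) O, φ Z = g' * evL k y z * g ∧
      rM Z = ∑ i, r (κ (evL k a z i.1 i.2)) • E i := by
    intro z hz
    obtain ⟨c, hc, hcr⟩ := hco z hz
    refine ⟨∑ i, c i • R i, ?_, ?_⟩
    · rw [hc, map_sum, Finset.mul_sum, Finset.sum_mul]
      refine Finset.sum_congr rfl fun i _ => ?_
      rw [mul_smul_comm, smul_mul_assoc, ← hR]
      ext s t
      simp [φ]
    · rw [map_sum]
      refine Finset.sum_congr rfl fun i _ => ?_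
      rw [← hcr]
      ext s t
      simp [rM, E, r]
  have hgg : ∀ A B : Matrix (Fin n) (Fin n) L, g' * (A * B) * g = (g' * A * g) * (g' * B * g) := by
    intro A B
    calc g' * (A * B) * g = g' * A * 1 * B * g := by simp only [mul_one, mul_assoc]
      _ = _ := by rw [← h1]; simp only [mul_assoc]
  have hEE : ∀ i j, E i * E j = ∑ l : Fin n × Fin n, r (κ ((Matrix.single i.1 i.2 (1:k) *
      Matrix.single j.1 j.2 1 : Matrix (Fin n) (Fin n) k) l.1 l.2)) • E l := by
    intro i j
    obtain ⟨Z, hZ, hZr⟩ := hz (p i * p j) (mul_mem (hp _) (hp _))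
    have : Z = R i * R j := by
      apply hφ
      rw [hZ, map_mul, map_mul, hgg, ← hR, ← hR]
    rw [map_mul, hpa, hpa] at hZr
    rw [← hZr, this, map_mul]
  obtain ⟨h, hh, hEh⟩ := units_conj hn E
    (by
      intro i j l
      rw [hEE]
      simp only [Matrix.single_mul_single_same, mul_one]
      rw [Finset.sum_eq_single (i, l)]
      · simp
      · rintro ⟨s, t⟩ _ hst
        have : ¬ (i = s ∧ l = t) := fun h' => hst (by rw [h'.1, h'.2])
        simp [Matrix.single_apply, this]
      · simp)
    (by
      intro i j j' l hj
      rw [hEE]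
      simp [Matrix.single_mul_single_of_ne, hj])
    (by
      obtain ⟨Z, hZ, hZr⟩ := hz 1 (one_mem _)
      have : Z = 1 := by
        apply hφ
        rw [hZ, map_one, map_one, mul_one, h2]
      rw [this, map_one, map_one] at hZr
      rw [hZr, Fintype.sum_prod_type]
      refine Finset.sum_congr rfl fun i _ => ?_
      rw [Finset.sum_eq_single i]
      · simp
      · intro j _ hj
        simp [Matrix.one_apply, hj.symm]
      · simp)
  obtain ⟨H, hH⟩ : ∃ H, rM H = h := by
    choose q hq using IsLocalRing.residue_surjective (R := O)
    refine ⟨h.map q, ?_⟩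
    ext i j
    exact hq _
  have hHdet : IsUnit H.det := by
    apply (IsLocalRing.residue_ne_zero_iff_isUnit _).mp
    rw [RingHom.map_det]
    rw [show (IsLocalRing.residue O).mapMatrix H = h from hH]
    exact ((Matrix.isUnit_iff_isUnit_det _).mp hh).ne_zero
  have hHi := Matrix.mul_nonsing_inv H hHdet
  have hHi' := Matrix.nonsing_inv_mul H hHdet
  choose Z hZ hZr using fun t : Fin m => hz (genericMatrix k n m t)
    (Algebra.subset_adjoin ⟨t, rfl⟩)
  let Y : Fin m → Matrix (Fin n) (Fin n) O := fun t => H⁻¹ * Z t * H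
  have hYr : ∀ t, rM (Y t) = (a t).map (r.comp κ) := by
    intro t
    have e1 : rM (Z t) * h = h * (a t).map (r.comp κ) := by
      rw [hZr, Finset.sum_mul]
      simp only [smul_mul_assoc, hEh, ← mul_smul_comm]
      rw [← Finset.mul_sum]
      congr 1
      conv_rhs => rw [Matrix.matrix_eq_sum_single ((a t).map (r.comp κ))]
      rw [Fintype.sum_prod_type]
      refine Finset.sum_congr rfl fun i _ => Finset.sum_congr rfl fun j _ => ?_
      rw [evL_generic]
      simp [Matrix.smul_single]
    have e2 : rM H⁻¹ * h = 1 := by rw [← hH, ← map_mul, hHi', map_one]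
    rw [map_mul, map_mul, hH, mul_assoc, e1, ← mul_assoc, e2, one_mul]
  have hYL : ∀ t, φ (Y t) = (φ H⁻¹ * g') * y t * (g * φ H) := by
    intro t
    rw [map_mul, map_mul, hZ, evL_generic]
    simp only [mul_assoc]
  have hf' := hf (φ H⁻¹ * g') (g * φ H)
    (by
      calc (φ H⁻¹ * g') * (g * φ H) = φ H⁻¹ * (g' * g) * φ H := by simp only [mul_assoc]
        _ = 1 := by rw [h2, mul_one, ← map_mul, hHi', map_one])
    (by
      calc g * φ H * (φ H⁻¹ * g') = g * (φ H * φ H⁻¹) * g' := by simp only [mul_assoc]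
        _ = 1 := by rw [← map_mul, hHi, map_one, mul_one, h1])
  simp only [← hYL] at hf'
  have hO : MvPolynomial.eval₂ κ (fun x : MIdx n m => Y x.1 x.2.1 x.2.2) f = 0 := by
    apply Subtype.val_injective (p := fun x => x ∈ O)
    have := MvPolynomial.hom_eval₂ f κ O.subtype (fun x : MIdx n m => Y x.1 x.2.1 x.2.2)
    refine this.trans ?_
    rw [MvPolynomial.aeval_def] at hf'
    have e : O.subtype.comp κ = algebraMap k L := by
      ext c
      exact hκ c
    rw [e]
    exact hf'
  have h5 := MvPolynomial.hom_eval₂ f κ r (fun x : MIdx n m => Y x.1 x.2.1 x.2.2)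
  rw [hO, map_zero] at h5
  have h6 := MvPolynomial.hom_eval₂ f (RingHom.id k) (r.comp κ)
    (fun x : MIdx n m => a x.1 x.2.1 x.2.2)
  have h7 : (fun x : MIdx n m => r (Y x.1 x.2.1 x.2.2)) =
      fun x : MIdx n m => (r.comp κ) (a x.1 x.2.1 x.2.2) := by
    ext x
    exact congrFun (congrFun (hYr x.1) x.2.1) x.2.2
  have h8 : (r.comp κ) (polyEval k a f) = 0 := by
    refine Eq.trans h6 (Eq.trans ?_ h5.symm)
    rw [RingHom.comp_id]
    exact congrArg (fun v => MvPolynomial.eval₂ (r.comp κ) v f) h7.symm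
  exact (map_eq_zero _).mp h8
end
end

noncomputable section
section
variable {k : Type} [Field k] {n m : ℕ}

theorem exists_point [IsAlgClosed k] (P : Ideal (PolyRing k n m)) [hP : P.IsPrime]
    (q : PolyRing k n m) (hq : q ∉ P) :
    ∃ b : MTuple k n m, (∀ f ∈ P, polyEval k b f = 0) ∧ polyEval k b q ≠ 0 := by
  by_contra hcon
  push Not at hcon
  apply hq
  rw [← MvPolynomial.IsPrime.vanishingIdeal_zeroLocus (K := k) P, MvPolynomial.mem_vanishingIdeal_iff]
  intro x hx
  exact hcon (fun h i j => x (h, i, j)) (fun f hf => hx f hf)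

theorem generic_conj (L : Type) [Field L] (n : ℕ) :
    ∃ (B : Type) (_ : CommRing B) (_ : IsDomain B) (_ : Algebra L B)
      (G G' : Matrix (Fin n) (Fin n) B), G * G' = 1 ∧ G' * G = 1 ∧
      ∀ g g' : Matrix (Fin n) (Fin n) L, g * g' = 1 → g' * g = 1 →
        ∃ σ : B →ₐ[L] L, G.map σ = g ∧ G'.map σ = g' := by
  classical
  let X : Matrix (Fin n) (Fin n) (MvPolynomial (Fin n × Fin n) L) :=
    Matrix.mvPolynomialX (Fin n) (Fin n) L
  have hX : X.det ≠ 0 := Matrix.det_mvPolynomialX_ne_zero (Fin n) L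
  let B := Localization.Away X.det
  have hB : IsDomain B := IsLocalization.isDomain_localization
    (powers_le_nonZeroDivisors_of_noZeroDivisors hX)
  let G : Matrix (Fin n) (Fin n) B := X.map (algebraMap _ B)
  have hGdet : IsUnit G.det := by
    have : G.det = algebraMap _ B X.det := (RingHom.map_det (algebraMap _ B) X).symm
    rw [this]
    exact IsLocalization.Away.algebraMap_isUnit _
  refine ⟨B, inferInstance, hB, inferInstance, G, G⁻¹, Matrix.mul_nonsing_inv _ hGdet,
    Matrix.nonsing_inv_mul _ hGdet, fun g g' h1 h2 => ?_⟩
  let s : MvPolynomial (Fin n × Fin n) L →ₐ[L] L := MvPolynomial.aeval fun x => g x.1 x.2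
  have hs : X.map s = g := by
    ext i j
    simp [X, s, Matrix.mvPolynomialX]
  have hsu : IsUnit (s.toRingHom X.det) := by
    have : s.toRingHom X.det = g.det := by
      rw [RingHom.map_det]
      exact congrArg Matrix.det hs
    rw [this]
    exact (Matrix.isUnit_iff_isUnit_det _).mp (IsUnit.of_mul_eq_one _ h1)
  let σ₀ : B →+* L := IsLocalization.Away.lift X.det hsu
  have hσ₀ : ∀ x, σ₀ (algebraMap _ B x) = s x := fun x => IsLocalization.Away.lift_eq X.det hsu x
  let σ : B →ₐ[L] L := { σ₀ with
    commutes' := by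
      intro c
      show σ₀ (algebraMap L B c) = _
      rw [IsScalarTower.algebraMap_apply L (MvPolynomial (Fin n × Fin n) L) B, hσ₀]
      simp [s] }
  have hG : G.map σ = g := by
    rw [← hs]
    ext i j
    exact hσ₀ _
  refine ⟨σ, hG, ?_⟩
  have h3 : G.map σ * G⁻¹.map σ = 1 := by
    rw [← Matrix.map_mul, Matrix.mul_nonsing_inv _ hGdet, Matrix.map_one _ (map_zero _) (map_one _)]
  rw [hG] at h3
  calc G⁻¹.map σ = g' * g * G⁻¹.map σ := by rw [h2, one_mul]
    _ = g' := by rw [mul_assoc, h3, mul_one]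

theorem linIndep_iff_det {S : Type} [Field S] (M : Fin n × Fin n → Matrix (Fin n) (Fin n) S) :
    LinearIndependent S M ↔
      (Matrix.of fun (i j : Fin n × Fin n) => M i j.1 j.2).det ≠ 0 := by
  classical
  rw [← isUnit_iff_ne_zero, ← Matrix.isUnit_iff_isUnit_det, ← Matrix.linearIndependent_rows_iff_isUnit]
  let e : Matrix (Fin n) (Fin n) S ≃ₗ[S] (Fin n × Fin n → S) :=
    (LinearEquiv.curry S S (Fin n) (Fin n)).symm
  exact (LinearMap.linearIndependent_iff e.toLinearMap e.ker).symm

theorem exists_basis {L : Type} [Field L] [Algebra k L] (y : Fin m → Matrix (Fin n) (Fin n) L)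
    (hspan : Submodule.span L (evL k y '' (GMN k n m : Set (MatPoly k n m))) = ⊤) :
    ∃ p : Fin n × Fin n → MatPoly k n m, (∀ i, p i ∈ GMN k n m) ∧
      LinearIndependent L (fun i => evL k y (p i)) := by
  obtain ⟨f, hf, -, hli⟩ := Submodule.exists_fun_fin_finrank_span_eq L
    (evL k y '' (GMN k n m : Set (MatPoly k n m)))
  have hc : Fintype.card (Fin n × Fin n) = Module.finrank L
      (Submodule.span L (evL k y '' (GMN k n m : Set (MatPoly k n m)))) := by
    rw [hspan, finrank_top, Module.finrank_matrix]
    simp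
  let e := Fintype.equivFinOfCardEq hc
  choose p hp hpf using fun i => hf (e i)
  refine ⟨p, hp, ?_⟩
  simp only [hpf]
  exact hli.comp e e.injective

theorem evL_mem_adjoin (b : MTuple k n m) {p : MatPoly k n m} (hp : p ∈ GMN k n m) :
    evL k b p ∈ Algebra.adjoin k (Set.range b) := by
  have : GMN k n m ≤ (Algebra.adjoin k (Set.range b)).comap (evL k b) := by
    apply Algebra.adjoin_le
    rintro _ ⟨h, rfl⟩
    show evL k b _ ∈ Algebra.adjoin k (Set.range b)
    rw [evL_generic]
    exact Algebra.subset_adjoin ⟨h, rfl⟩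
  exact this hp

theorem evL_map {S S' : Type} [CommRing S] [Algebra k S] [CommRing S'] [Algebra k S']
    (s : S →ₐ[k] S') (y : Fin m → Matrix (Fin n) (Fin n) S) (p : MatPoly k n m) :
    (evL k y p).map s = evL k (fun h => (y h).map s) p := by
  ext i j
  rw [Matrix.map_apply, evL_apply, evL_apply, MvPolynomial.comp_aeval_apply]
  rfl

theorem core [IsAlgClosed k] [CharZero k] (hn : 1 ≤ n) {L : Type} [Field L] [Algebra k L]
    (y : Fin m → Matrix (Fin n) (Fin n) L)
    (hspan : Submodule.span L (evL k y '' (GMN k n m : Set (MatPoly k n m))) = ⊤)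
    (J : TwoSidedIdeal (GMN k n m)) (hker : ∀ p : GMN k n m, p ∈ J ↔ evL k y p = 0) :
    IsIrredSubset k (zeroLocusI k J) := by
  classical
  obtain ⟨p, hp, hli⟩ := exists_basis y hspan
  obtain ⟨B, _, _, _, G, G', hG, hG', hspec⟩ := generic_conj L n
  let _ : Algebra k B := ((algebraMap L B).comp (algebraMap k L)).toAlgebra
  have : IsScalarTower k L B := IsScalarTower.of_algebraMap_eq fun _ => rfl
  let yB : Fin m → Matrix (Fin n) (Fin n) B := fun h => (y h).map (IsScalarTower.toAlgHom k L B)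
  let Y : Fin m → Matrix (Fin n) (Fin n) B := fun h => G * yB h * G'
  let Φ : PolyRing k n m →ₐ[k] B := MvPolynomial.aeval fun x : MIdx n m => Y x.1 x.2.1 x.2.2
  let P : Ideal (PolyRing k n m) := RingHom.ker Φ
  have hP : P.IsPrime := RingHom.ker_isPrime Φ
  have hσ : ∀ g g' : Matrix (Fin n) (Fin n) L, g * g' = 1 → g' * g = 1 → ∃ σ : B →ₐ[k] L,
      ∀ f, σ (Φ f) = (MvPolynomial.aeval fun x : MIdx n m => (g * y x.1 * g') x.2.1 x.2.2) f := by
    intro g g' h1 h2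
    obtain ⟨σ, e1, e2⟩ := hspec g g' h1 h2
    refine ⟨σ.restrictScalars k, fun f => ?_⟩
    rw [MvPolynomial.comp_aeval_apply]
    congr 2
    ext x
    have : (Y x.1).map σ = g * y x.1 * g' := by
      simp only [Y, Matrix.map_mul, e1, e2]
      congr 2
      ext i j
      simp [yB]
    exact congrFun (congrFun this x.2.1) x.2.2
  let d : PolyRing k n m := (Matrix.of fun (i j : Fin n × Fin n) => p i j.1 j.2).det
  have hdev : ∀ {S : Type} [Field S] [Algebra k S] (w : Fin m → Matrix (Fin n) (Fin n) S),
      (MvPolynomial.aeval fun x : MIdx n m => w x.1 x.2.1 x.2.2) d =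
        (Matrix.of fun (i j : Fin n × Fin n) => evL k w (p i) j.1 j.2).det := by
    intro S _ _ w
    rw [AlgHom.map_det]
    rfl
  have hd : d ∉ P := by
    intro h
    obtain ⟨σ, hσ⟩ := hσ 1 1 (one_mul 1) (one_mul 1)
    have h0 : σ (Φ d) = 0 := by
      rw [show Φ d = 0 from h, map_zero]
    rw [hσ] at h0
    simp only [one_mul, mul_one] at h0
    rw [hdev] at h0
    exact (linIndep_iff_det _).mp hli h0
  have hin : ∀ b : MTuple k n m, (∀ f ∈ P, polyEval k b f = 0) → polyEval k b d ≠ 0 →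
      b ∈ zeroLocusI k J := by
    intro b hb hbd
    refine ⟨?_, ?_⟩
    · have h1 : LinearIndependent k (fun i => evL k b (p i)) := by
        rw [linIndep_iff_det, ← hdev]
        exact hbd
      have h2 : Submodule.span k (Set.range fun i => evL k b (p i)) = ⊤ := by
        apply h1.span_eq_top_of_card_eq_finrank'
        rw [Module.finrank_matrix]
        simp
      show Algebra.adjoin k (Set.range b) = ⊤
      rw [eq_top_iff]
      intro M _
      have h3 : Submodule.span k (Set.range fun i => evL k b (p i)) ≤
          Subalgebra.toSubmodule (Algebra.adjoin k (Set.range b)) := by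
        rw [Submodule.span_le]
        rintro _ ⟨i, rfl⟩
        exact evL_mem_adjoin b (hp i)
      apply h3
      rw [h2]
      trivial
    · intro q hq
      show evL k b q = 0
      ext i j
      rw [evL_apply]
      apply hb
      show Φ _ = 0
      have h1 : evL k Y (q : MatPoly k n m) = 0 := by
        rw [evL_conj yB G G' hG hG' _ q.2, ← evL_map, (hker q).mp hq]
        simp
      rw [← evL_apply, h1]
      rfl
  have hvan : ∀ a ∈ zeroLocusI k J, ∀ f ∈ P, polyEval k a f = 0 := by
    rintro a ⟨ha, haJ⟩ f hf
    refine specialize_conj hn y a ha ?_ f ?_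
    · intro q hq h0
      exact haJ ⟨q, hq⟩ ((hker ⟨q, hq⟩).mpr h0)
    · intro g g' h1 h2
      obtain ⟨σ, hσ⟩ := hσ g g' h1 h2
      rw [← hσ, show Φ f = 0 from hf, map_zero]
  refine ⟨?_, ?_⟩
  · obtain ⟨b, hb, hbd⟩ := exists_point P d hd
    exact ⟨b, hin b hb hbd⟩
  · rintro C₁ C₂ ⟨S₁, rfl⟩ ⟨S₂, rfl⟩ hsub
    by_contra hcon
    push Not at hcon
    obtain ⟨hc1, hc2⟩ := hcon
    have hex : ∀ S : Set (PolyRing k n m), ¬ zeroLocusI k J ⊆ {a | ∀ p ∈ S, polyEval k a p = 0} →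
        ∃ f ∈ S, f ∉ P := by
      intro S hS
      by_contra h
      push Not at h
      exact hS fun a ha f hf => hvan a ha f (h f hf)
    obtain ⟨f₁, hf₁, hf₁P⟩ := hex S₁ hc1
    obtain ⟨f₂, hf₂, hf₂P⟩ := hex S₂ hc2
    obtain ⟨b, hb, hbd⟩ := exists_point P (f₁ * f₂ * d) (by
      intro h
      rcases hP.mem_or_mem h with h | h
      · rcases hP.mem_or_mem h with h | h
        · exact hf₁P h
        · exact hf₂P h
      · exact hd h)
    rw [map_mul, map_mul] at hbd
    rcases hsub (hin b hb (right_ne_zero_of_mul hbd)) with h | h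
    · exact hbd (by rw [h f₁ hf₁]; simp)
    · exact hbd (by rw [h f₂ hf₂]; simp)
end
end

noncomputable section
section
variable {k : Type} [Field k] {n m : ℕ}

theorem final_irred [IsAlgClosed k] [CharZero k] (hn : 1 ≤ n)
    (J : TwoSidedIdeal (GMN k n m)) (hJ : J ∈ SpecN n (GMN k n m)) :
    IsIrredSubset k (zeroLocusI k J) := by
  obtain ⟨L, _, ψ, hinj, hspan, ι, hι⟩ := exists_split hn (idealQuot J) hJ.2
  let π : GMN k n m →+* idealQuot J := J.ringCon.mk'
  have hπ : Function.Surjective π := J.ringCon.mk'_surjective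
  have hcen : ∀ c : k, π (algebraMap k (GMN k n m) c) ∈ Subring.center (idealQuot J) := by
    intro c
    rw [Subring.mem_center_iff]
    intro x
    obtain ⟨x, rfl⟩ := hπ x
    rw [← map_mul, ← map_mul, Algebra.commutes]
  let θ : k →+* Subring.center (idealQuot J) :=
    (π.comp (algebraMap k (GMN k n m))).codRestrict _ hcen
  let _ : Algebra k L := (ι.comp θ).toAlgebra
  let y : Fin m → Matrix (Fin n) (Fin n) L := fun h =>
    ψ (π ⟨genericMatrix k n m h, Algebra.subset_adjoin ⟨h, rfl⟩⟩)
  have hψ : ∀ (p : MatPoly k n m) (hp : p ∈ GMN k n m), ψ (π ⟨p, hp⟩) = evL k y p := by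
    intro p hp
    refine Algebra.adjoin_induction (p := fun p hp => ψ (π ⟨p, hp⟩) = evL k y p) ?_ ?_ ?_ ?_ hp
    · rintro _ ⟨h, rfl⟩
      rw [evL_generic]
    · intro c
      rw [AlgHom.commutes]
      exact hι (θ c)
    · intro p q hp hq h1 h2
      rw [map_add, ← h1, ← h2, ← map_add, ← map_add]
      rfl
    · intro p q hp hq h1 h2
      rw [map_mul, ← h1, ← h2, ← map_mul, ← map_mul]
      rfl
  refine core hn y ?_ J ?_
  · rw [← hspan]
    congr 1
    ext M
    constructor
    · rintro ⟨p, hp, rfl⟩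
      exact ⟨_, hψ p hp⟩
    · rintro ⟨x, rfl⟩
      obtain ⟨p, rfl⟩ := hπ x
      exact ⟨p, p.2, (hψ p p.2).symm⟩
  · intro p
    rw [← hψ p p.2, map_eq_zero_iff ψ hinj]
    show p ∈ J ↔ π p = 0
    rw [TwoSidedIdeal.mem_iff, ← map_zero π]
    exact (RingCon.eq _).symm
end
end

/-- **Statement 9** (Corollary cor.central.Gmn).  If `J₀ ∈ Spec_n(G_{m,n})`, then
the zero locus `Z(J₀) ⊆ U_{m,n}` is irreducible. -/
theorem spec_G_zero_locus_irreducible (n m : ℕ) (hn : 1 ≤ n) (hm : 2 ≤ m)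
    (J₀ : TwoSidedIdeal ↥(GMN k n m)) (hJ : J₀ ∈ SpecN n ↥(GMN k n m)) :
    IsIrredSubset k (zeroLocusI k J₀) := by
  exact final_irred hn J₀ hJ

end
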